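/- Suppose a flag complex L is a subcomplex of a simplicial complex K. Then there is a subdivision K' of K (the partial barycentric subdivision of K relative to L) such that L is a full subcomplex of K' and K' is a flag complex. -/

import Mathlib

open Finset

/-- An abstract simplicial complex on the vertex type `V`: a collection of nonempty
finite subsets of `V` (the simplices, or faces) closed under passing to nonempty subsets. -/
structure SCplx (V : Type) where
  faces : Set (Finset V)
  down_closed : ∀ ⦃s t : Finset V⦄, s ∈ faces → t ⊆ s → t.Nonempty → t ∈ faces
  nonempty_of_mem : ∀ ⦃s : Finset V⦄, s ∈ faces → s.Nonempty

variable {V : Type}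

/-- `L` is a `k`-dimensional complex: every simplex has at most `k+1` vertices and
some simplex has exactly `k+1` vertices. -/
def IsDimOf (L : SCplx V) (k : ℕ) : Prop :=
  (∀ s ∈ L.faces, s.card ≤ k + 1) ∧ ∃ s ∈ L.faces, s.card = k + 1

variable [DecidableEq V] in
/-- A flag complex: every nonempty set of pairwise adjacent vertices spans a simplex. -/
def IsFlag (L : SCplx V) : Prop :=
  ∀ s : Finset V, s.Nonempty →
    (∀ u ∈ s, ∀ w ∈ s, ({u, w} : Finset V) ∈ L.faces) → s ∈ L.faces

section Oct

variable [DecidableEq V]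

/-- The projection `OL → L` on simplices, induced by `V × {±1} → V`
(`Bool` plays the role of `{±1}`, with `false` the minus sign). -/
def pface (s : Finset (V × Bool)) : Finset V := s.image Prod.fst

/-- The octahedralization `OL` of `L`: vertices are doubled, and a set of doubled
vertices spans a simplex iff its first coordinates are distinct and span a simplex of `L`. -/
def oct (L : SCplx V) : SCplx (V × Bool) where
  faces := {s | pface s ∈ L.faces ∧ (pface s).card = s.card}
  down_closed := by
    rintro s t ⟨hf, hc⟩ hts hne
    refine ⟨L.down_closed hf (Finset.image_subset_image hts) ?_, ?_⟩
    · obtain ⟨x, hx⟩ := hne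
      exact ⟨x.1, Finset.mem_image_of_mem _ hx⟩
    · rw [pface, Finset.card_image_iff] at hc ⊢
      exact hc.mono (Finset.coe_subset.mpr hts)
  nonempty_of_mem := by
    rintro s ⟨hf, hc⟩
    by_contra h
    rw [Finset.not_nonempty_iff_eq_empty] at h
    subst h
    simp [pface] at hf
    exact absurd (L.nonempty_of_mem hf) (by simp)

/-- The full subcomplex of `K` on a set `A` of vertices. -/
def fullSub (K : SCplx V) (A : Finset V) : SCplx V where
  faces := {s | s ∈ K.faces ∧ s ⊆ A}
  down_closed := by
    rintro s t ⟨hs, hA⟩ hts ht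
    exact ⟨K.down_closed hs hts ht, hts.trans hA⟩
  nonempty_of_mem := by
    rintro s ⟨hs, -⟩
    exact K.nonempty_of_mem hs

/-- The link of a simplex `σ` in `L`. -/
def scLink (L : SCplx V) (σ : Finset V) : SCplx V where
  faces := {τ | Disjoint σ τ ∧ σ ∪ τ ∈ L.faces ∧ τ.Nonempty}
  down_closed := by
    rintro s t ⟨hd, hf, -⟩ hts ht
    refine ⟨hd.mono_right hts, L.down_closed hf (Finset.union_subset_union (subset_refl σ) hts) ?_, ht⟩
    obtain ⟨x, hx⟩ := ht
    exact ⟨x, Finset.mem_union_right _ hx⟩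
  nonempty_of_mem := by
    rintro s ⟨-, -, h⟩
    exact h

/-- The closed star of a simplex `σ` in `L`; one has `St(σ) = Lk(σ) * σ`. -/
def scStar (L : SCplx V) (σ : Finset V) : SCplx V where
  faces := {τ | τ.Nonempty ∧ σ ∪ τ ∈ L.faces}
  down_closed := by
    rintro s t ⟨-, hf⟩ hts ht
    refine ⟨ht, L.down_closed hf (Finset.union_subset_union (subset_refl σ) hts) ?_⟩
    obtain ⟨x, hx⟩ := ht
    exact ⟨x, Finset.mem_union_right _ hx⟩
  nonempty_of_mem := by
    rintro s ⟨h, -⟩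
    exact h

end Oct

/-- The simplicial join of two complexes. -/
def scJoin {V₁ V₂ : Type} [DecidableEq V₁] [DecidableEq V₂]
    (K₁ : SCplx V₁) (K₂ : SCplx V₂) : SCplx (V₁ ⊕ V₂) where
  faces := {s | s.Nonempty ∧ ∃ (s₁ : Finset V₁) (s₂ : Finset V₂),
    s = s₁.image Sum.inl ∪ s₂.image Sum.inr ∧
    (s₁ = ∅ ∨ s₁ ∈ K₁.faces) ∧ (s₂ = ∅ ∨ s₂ ∈ K₂.faces)}
  down_closed := by
    rintro s t ⟨hne, s₁, s₂, rfl, h₁, h₂⟩ hts htne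
    refine ⟨htne, s₁.filter (fun v => Sum.inl v ∈ t), s₂.filter (fun v => Sum.inr v ∈ t),
      ?_, ?_, ?_⟩
    · ext x
      simp only [Finset.mem_union, Finset.mem_image, Finset.mem_filter]
      constructor
      · intro hx
        have hx' := hts hx
        simp only [Finset.mem_union, Finset.mem_image] at hx'
        rcases hx' with ⟨v, hv, rfl⟩ | ⟨v, hv, rfl⟩
        · exact Or.inl ⟨v, ⟨hv, hx⟩, rfl⟩
        · exact Or.inr ⟨v, ⟨hv, hx⟩, rfl⟩
      · rintro (⟨v, ⟨hv, hvt⟩, rfl⟩ | ⟨v, ⟨hv, hvt⟩, rfl⟩) <;> assumption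
    · by_cases h : s₁.filter (fun v => Sum.inl v ∈ t) = ∅
      · exact Or.inl h
      · right
        rcases h₁ with rfl | h₁
        · simp at h
        · exact K₁.down_closed h₁ (Finset.filter_subset _ _)
            (Finset.nonempty_iff_ne_empty.mpr h)
    · by_cases h : s₂.filter (fun v => Sum.inr v ∈ t) = ∅
      · exact Or.inl h
      · right
        rcases h₂ with rfl | h₂
        · simp at h
        · exact K₂.down_closed h₂ (Finset.filter_subset _ _)
            (Finset.nonempty_iff_ne_empty.mpr h)
  nonempty_of_mem := by
    rintro s ⟨h, -⟩
    exact h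

/-! ### Right-angled Artin groups -/

/-- The standard commutator relators of the right-angled Artin group on the 1-skeleton of `L`. -/
def raagRels [DecidableEq V] (L : SCplx V) : Set (FreeGroup V) :=
  {r | ∃ u w : V, u ≠ w ∧ ({u, w} : Finset V) ∈ L.faces ∧
    r = FreeGroup.of u * FreeGroup.of w * (FreeGroup.of u)⁻¹ * (FreeGroup.of w)⁻¹}

/-- The right-angled Artin group `A_L` associated to a flag complex `L`:
one generator for each vertex, with commuting relations along the edges of `L`. -/
def RAAG [DecidableEq V] (L : SCplx V) : Type := PresentedGroup (raagRels L)

instance [DecidableEq V] (L : SCplx V) : Group (RAAG L) :=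
  inferInstanceAs (Group (PresentedGroup (raagRels L)))

/-! ### Geometric realization -/

/-- The standard basis vertex placement for the geometric realization. -/
def stdVert [DecidableEq V] (v : V) : V → ℝ := fun w => if w = v then 1 else 0

/-- The geometric realization of an abstract simplicial complex, inside `V → ℝ`. -/
def realization [DecidableEq V] (L : SCplx V) : Set (V → ℝ) :=
  ⋃ s ∈ L.faces, convexHull ℝ (stdVert '' (s : Set V))

/-! ### Action dimension and geometric dimension -/

/-- The action dimension of a group `Γ`: the least dimension of a contractible
(topological) manifold admitting a proper (i.e. properly discontinuous, by
homeomorphisms) `Γ`-action; `⊤` if there is no such manifold. -/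
noncomputable def actdim (Γ : Type) [Group Γ] : ℕ∞ :=
  sInf {n : ℕ∞ | ∃ m : ℕ, n = (m : ℕ∞) ∧
    ∃ (M : Type) (_ : TopologicalSpace M) (_ : T2Space M)
      (_ : ChartedSpace (EuclideanSpace ℝ (Fin m)) M) (ρ : Γ →* Equiv.Perm M),
      ContractibleSpace M ∧ (∀ γ : Γ, Continuous (⇑(ρ γ) : M → M)) ∧
      ∀ K L : Set M, IsCompact K → IsCompact L →
        {γ : Γ | ((⇑(ρ γ) : M → M) '' K ∩ L).Nonempty}.Finite}

/-- The geometric dimension of a group `Γ`: the least dimension of a (simplicial) model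
for the classifying space `BΓ`, i.e. the least `m` such that `Γ` acts freely simplicially on
an `m`-dimensional contractible simplicial complex; `⊤` if there is no finite-dimensional
model. -/
noncomputable def gd (Γ : Type) [Group Γ] : ℕ∞ :=
  sInf {n : ℕ∞ | ∃ m : ℕ, n = (m : ℕ∞) ∧
    ∃ (W : Type) (_ : DecidableEq W) (X : SCplx W) (ρ : Γ →* Equiv.Perm W),
      (∀ (γ : Γ), ∀ s ∈ X.faces, s.image (ρ γ) ∈ X.faces) ∧
      (∀ (γ : Γ), γ ≠ 1 → ∀ s ∈ X.faces, s.image (ρ γ) ≠ s) ∧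
      (∀ s ∈ X.faces, s.card ≤ m + 1) ∧
      ContractibleSpace (realization X)}

/-! ### PL embeddings and embedding dimension -/

/-- A compact polyhedron in a real vector space: a finite union of polytopes. -/
def IsCompactPolyhedron {E : Type*} [AddCommGroup E] [Module ℝ E] (S : Set E) : Prop :=
  ∃ F : Finset (Finset E), S = ⋃ t ∈ F, convexHull ℝ (t : Set E)

/-- A piecewise linear embedding of the compact polyhedron `P` into `Q`: an injective
map `P → Q` whose graph is a compact polyhedron. -/
def HasPLEmbedding {E₁ E₂ : Type*} [AddCommGroup E₁] [Module ℝ E₁]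
    [AddCommGroup E₂] [Module ℝ E₂] (P : Set E₁) (Q : Set E₂) : Prop :=
  ∃ f : E₁ → E₂, Set.InjOn f P ∧ f '' P ⊆ Q ∧
    IsCompactPolyhedron {p : E₁ × E₂ | p.1 ∈ P ∧ p.2 = f p.1}

/-- The boundary complex of the `(m+1)`-simplex, a standard PL `m`-sphere. -/
def sphereCplx (m : ℕ) : SCplx (Fin (m + 2)) where
  faces := {s | s.Nonempty ∧ s ≠ Finset.univ}
  down_closed := by
    rintro s t ⟨-, hs⟩ hts ht
    refine ⟨ht, fun h => hs ?_⟩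
    exact Finset.univ_subset_iff.mp (h ▸ hts)
  nonempty_of_mem := fun _ h => h.1

/-- `K` embeds piecewise linearly in the sphere `S^m`. -/
def PLEmbedsInSphere [DecidableEq V] (K : SCplx V) (m : ℕ) : Prop :=
  HasPLEmbedding (realization K) (realization (sphereCplx m))

/-- The embedding dimension of `K`: the least `m` such that `K` piecewise linearly
embeds in `S^m`. -/
noncomputable def embdim [DecidableEq V] (K : SCplx V) : ℕ :=
  sInf {m | PLEmbedsInSphere K m}

/-! ### Simplicial chains and homology mod 2 -/

/-- A simplicial `k`-chain with `ℤ/2` coefficients on `L`, recorded as its coefficient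
function on finite vertex sets: it is supported on the `k`-simplices of `L`. -/
def IsChainOn (L : SCplx V) (k : ℕ) (c : Finset V → ZMod 2) : Prop :=
  ∀ s, c s ≠ 0 → s ∈ L.faces ∧ s.card = k + 1

/-- The mod 2 simplicial boundary operator (the coefficient of `∂c` on `t` is the sum
of the coefficients of `c` over the cofaces of `t`). -/
noncomputable def bd2 [Fintype V] [DecidableEq V] (c : Finset V → ZMod 2) :
    Finset V → ZMod 2 :=
  fun t => ∑ x ∈ tᶜ, c (insert x t)

/-- `c` is a mod 2 simplicial `k`-cycle on `L`. -/
def IsCycleOn [Fintype V] [DecidableEq V] (L : SCplx V) (k : ℕ)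
    (c : Finset V → ZMod 2) : Prop :=
  IsChainOn L k c ∧ ∀ t : Finset V, t.Nonempty → bd2 c t = 0

/-- `H_k(L; ℤ/2) ≠ 0`: there is a mod 2 `k`-cycle which is not a boundary. -/
def ModTwoHomologyNonzero [Fintype V] [DecidableEq V] (L : SCplx V) (k : ℕ) : Prop :=
  ∃ c, IsCycleOn L k c ∧ ¬∃ d, IsChainOn L (k + 1) d ∧ bd2 d = c

/-! ### The van Kampen obstruction -/

/-- An (ordered) cell `σ × τ` of the simplicial deleted product of `K`. -/
def IsCell {W : Type} (K : SCplx W) (σ τ : Finset W) : Prop :=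
  σ ∈ K.faces ∧ τ ∈ K.faces ∧ Disjoint σ τ

/-- An equivariant, augmentation-preserving chain map (mod 2) from the cellular chains of the
simplicial deleted product of `K` to the standard free resolution `W_*` of `ℤ/2` over
`ℤ/2[ℤ/2]` (the cellular chains of `S^∞ = EZ/2`); such a map classifies the free involution.
The value on a cell `(σ,τ)` is the pair of coefficients of `e_n` and `Te_n`, `n = dim σ×τ`. -/
structure VKMap {W : Type} [DecidableEq W] (K : SCplx W) where
  f : Finset W × Finset W → ZMod 2 × ZMod 2
  supp : ∀ p : Finset W × Finset W, ¬ IsCell K p.1 p.2 → f p = 0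
  symm : ∀ σ τ : Finset W, f (τ, σ) = (f (σ, τ)).swap
  aug : ∀ v w : W, IsCell K {v} {w} → (f ({v}, {w})).1 + (f ({v}, {w})).2 = 1
  chain : ∀ σ τ : Finset W, IsCell K σ τ → 3 ≤ σ.card + τ.card →
    ((∑ x ∈ σ, f (σ.erase x, τ)) + (∑ x ∈ τ, f (σ, τ.erase x))) =
      ((f (σ, τ)).1 + (f (σ, τ)).2, (f (σ, τ)).1 + (f (σ, τ)).2)

/-- The pullback under `Φ` of the standard cocycle representing `w_1^m` on `RP^∞` is a
coboundary in the complex of symmetric (= `ℤ/2`-equivariant) cochains on the deleted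
product, i.e. the class `vk^m_{ℤ/2}(K) = c^*(w_1^m) ∈ H^m(C(K); ℤ/2)` vanishes. -/
def vkClassVanishes {W : Type} [DecidableEq W] (K : SCplx W) (Φ : VKMap K) (m : ℕ) : Prop :=
  ∃ η : Finset W × Finset W → ZMod 2,
    (∀ p : Finset W × Finset W, ¬ IsCell K p.1 p.2 → η p = 0) ∧
    (∀ σ τ : Finset W, η (τ, σ) = η (σ, τ)) ∧
    ∀ σ τ : Finset W, IsCell K σ τ → σ.card + τ.card = m + 2 →
      ((∑ x ∈ σ, η (σ.erase x, τ)) + (∑ x ∈ τ, η (σ, τ.erase x))) =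
        (Φ.f (σ, τ)).1 + (Φ.f (σ, τ)).2

/-- Nonvanishing of the mod 2 van Kampen obstruction
`vk^m_{ℤ/2}(K) = c^*(w_1^m) ∈ H^m(C(K); ℤ/2)`. -/
def vkModTwoNonzero {W : Type} [DecidableEq W] (K : SCplx W) (m : ℕ) : Prop :=
  ∃ Φ : VKMap K, ¬ vkClassVanishes K Φ m

/-- The van Kampen dimension of `K`: the largest `m` with `vk^m_{ℤ/2}(K) ≠ 0`
(with the usual conventions `vkdim ∅ = -2` and `vkdim(point) = -1`). -/
noncomputable def vkdim {W : Type} [DecidableEq W] (K : SCplx W) : ℤ :=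
  sSup ({-2} ∪ {m : ℤ | (m = -1 ∧ K.faces.Nonempty) ∨
    ∃ n : ℕ, m = (n : ℤ) ∧ vkModTwoNonzero K n})

/-! ### The integral van Kampen obstruction -/

open Classical in
/-- The sign `(-1)^i` where `i` is the position of `x` in the simplex `σ` ordered by `lt`. -/
noncomputable def osign' {W : Type} (lt : W → W → Prop) (σ : Finset W) (x : W) : ℤ :=
  (-1) ^ (σ.filter (fun y => lt y x)).card

/-- An equivariant, augmentation-preserving integral chain map from the cellular chains of
the simplicial deleted product of `K` (cells oriented by the order `lt`, the involution acting
with the sign `(-1)^{dim σ · dim τ}`) to the standard free resolution `W_*` of `ℤ` over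
`ℤ[ℤ/2]` (with `∂e_n = e_{n-1} + (-1)^n Te_{n-1}`). -/
structure VKMapZ {W : Type} [DecidableEq W] (K : SCplx W) (lt : W → W → Prop) where
  f : Finset W × Finset W → ℤ × ℤ
  supp : ∀ p : Finset W × Finset W, ¬ IsCell K p.1 p.2 → f p = 0
  symm : ∀ σ τ : Finset W,
    f (τ, σ) = ((-1 : ℤ) ^ ((σ.card - 1) * (τ.card - 1))) • (f (σ, τ)).swap
  aug : ∀ v w : W, IsCell K {v} {w} → (f ({v}, {w})).1 + (f ({v}, {w})).2 = 1
  chain : ∀ σ τ : Finset W, IsCell K σ τ → 3 ≤ σ.card + τ.card →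
    ((∑ x ∈ σ, osign' lt σ x • f (σ.erase x, τ)) +
      ((-1 : ℤ) ^ (σ.card - 1)) • ∑ x ∈ τ, osign' lt τ x • f (σ, τ.erase x)) =
      ((f (σ, τ)).1 + (-1 : ℤ) ^ (σ.card + τ.card) * (f (σ, τ)).2,
       (-1 : ℤ) ^ (σ.card + τ.card) * (f (σ, τ)).1 + (f (σ, τ)).2)

/-- The integral van Kampen class `vk^m(K) = c^*(e_1^m) ∈ H^m(C(K); ℤ)` (in even degree `m`)
vanishes: the pullback under `Φ` of the standard invariant cocycle generating
`H^m(RP^∞;ℤ)` is a coboundary of an invariant integral cochain. -/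
def vkZClassVanishes {W : Type} [DecidableEq W] (K : SCplx W) (lt : W → W → Prop)
    (Φ : VKMapZ K lt) (m : ℕ) : Prop :=
  ∃ η : Finset W × Finset W → ℤ,
    (∀ p : Finset W × Finset W, ¬ IsCell K p.1 p.2 → η p = 0) ∧
    (∀ σ τ : Finset W, η (τ, σ) = ((-1 : ℤ) ^ ((σ.card - 1) * (τ.card - 1))) * η (σ, τ)) ∧
    ∀ σ τ : Finset W, IsCell K σ τ → σ.card + τ.card = m + 2 →
      ((∑ x ∈ σ, osign' lt σ x * η (σ.erase x, τ)) +
        ((-1 : ℤ) ^ (σ.card - 1)) * ∑ x ∈ τ, osign' lt τ x * η (σ, τ.erase x)) =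
        (Φ.f (σ, τ)).1 + (Φ.f (σ, τ)).2

/-- Nonvanishing of the integral van Kampen obstruction `vk^m(K) ∈ H^m(C(K); ℤ)`
(`m` even). -/
def vkZNonzero {W : Type} [DecidableEq W] (K : SCplx W) (lt : W → W → Prop) (m : ℕ) : Prop :=
  ∃ Φ : VKMapZ K lt, ¬ vkZClassVanishes K lt Φ m

/-! ### Orders and meshing -/

/-- The order on the doubled vertices `V × {±1}`: `v⁻ < v⁺ < w⁻ < w⁺ < ⋯` for `v < w`
(`false` is the minus sign). -/
def olt [LT V] (a b : V × Bool) : Prop :=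
  a.1 < b.1 ∨ (a.1 = b.1 ∧ a.2 = false ∧ b.2 = true)

/-- The reflexive closure of `olt`. -/
def ole [LT V] (a b : V × Bool) : Prop := olt a b ∨ a = b

/-- `Meshed r s [v₀,…,v_k] [w₀,…,w_k]` says `r v₀ w₀`, `s w₀ v₁`, `r v₁ w₁`, `s w₁ v₂`, … ,
`r v_k w_k`, i.e. the two vertex lists alternate with respect to the relations `r`, `s`. -/
def Meshed {α : Type*} (r s : α → α → Prop) : List α → List α → Prop
  | [a], [b] => r a b
  | a :: a' :: l₁, b :: l₂ => r a b ∧ s b a' ∧ Meshed r s (a' :: l₁) l₂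
  | _, _ => False

/-- `l` is the enumeration of the finite set `σ` in increasing order w.r.t. `r`. -/
def SListOf {α : Type*} [DecidableEq α] (r : α → α → Prop) (l : List α) (σ : Finset α) : Prop :=
  l.toFinset = σ ∧ l.Chain' r

open Classical in
/-- The standard integral cocycle `ν` representing the top-degree van Kampen obstruction:
on an oriented cell `[σ,τ]` of `C(OL)` (simplices oriented by increasing vertex order)
it is `1` if `σ,τ` mesh, `(-1)^k` if `τ,σ` mesh, `0` otherwise. -/
noncomputable def nuVal [LinearOrder V] (k : ℕ) (σ τ : Finset (V × Bool)) : ℤ :=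
  if ∃ l₁ l₂ : List (V × Bool), SListOf olt l₁ σ ∧ SListOf olt l₂ τ ∧ Meshed olt olt l₁ l₂
  then 1
  else if ∃ l₁ l₂ : List (V × Bool), SListOf olt l₁ σ ∧ SListOf olt l₂ τ ∧ Meshed olt olt l₂ l₁
  then (-1) ^ k
  else 0

open Classical in
/-- The cocycle `μ ∈ Z^{2k}(OL × L; ℤ)`: its value on a cell `(σ, b)` is `1` if
`σ` meshes nonstrictly with the minus-copy `b⁻` of `b` (that is,
`v₀ ≤ w₀⁻ < v₁ ≤ w₁⁻ < ⋯ ≤ w_k⁻`), and `0` otherwise. -/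
noncomputable def muVal [LinearOrder V] (σ : Finset (V × Bool)) (b : Finset V) : ℤ :=
  if ∃ (l₁ : List (V × Bool)) (l₂ : List V), SListOf olt l₁ σ ∧
      l₂.toFinset = b ∧ l₂.Chain' (· < ·) ∧
      Meshed ole olt l₁ (l₂.map (fun w => (w, false)))
  then 1 else 0

/-! ### The chains `Ω`, `s_*`, and `OΔ × M` -/

open Classical in
/-- The vertices of (the support of) a mod 2 cycle `M`. -/
noncomputable def cycVerts [Fintype V] [DecidableEq V] (M : Finset V → ZMod 2) : Finset V :=
  Finset.univ.filter (fun v => ∃ s, M s ≠ 0 ∧ v ∈ s)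

/-- The vertex set `M⁻ ∪ {v₀^±, …, v_k^±}` of `D`, the complex `M` doubled over `Δ`. -/
noncomputable def doubledVerts [Fintype V] [DecidableEq V] (M : Finset V → ZMod 2)
    (Δ : Finset V) : Finset (V × Bool) :=
  (cycVerts M).image (fun v => (v, false)) ∪ Δ.image (fun v => (v, false)) ∪
    Δ.image (fun v => (v, true))

open Classical in
/-- The mod 2 chain `Ω ∈ C_{2k}(C(D); ℤ/2)` (as a symmetric function on ordered pairs):
a `2k`-cell `[σ,τ]` of `C(D)` lies in `Ω` iff `σ ∩ τ = ∅` and `Δ⁰ ⊆ p(σ) ∪ p(τ)`. -/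
noncomputable def OmegaChain [DecidableEq V] (D : SCplx (V × Bool)) (Δ : Finset V) (k : ℕ) :
    Finset (V × Bool) × Finset (V × Bool) → ZMod 2 :=
  fun p => if IsCell D p.1 p.2 ∧ p.1.card + p.2.card = 2 * k + 2 ∧
      Δ ⊆ pface p.1 ∪ pface p.2 then 1 else 0

open Classical in
/-- The pushforward under the chain map
`s : C_*(C(OL)) → C_*(OL × L)`, `[σ,τ] ↦ (σ, p(τ)) + (τ, p(σ))` (mod 2), of a mod 2 chain on
`C(OL)` given as a symmetric function on ordered pairs. -/
noncomputable def pushS [Fintype V] [DecidableEq V]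
    (c : Finset (V × Bool) × Finset (V × Bool) → ZMod 2) :
    Finset (V × Bool) × Finset V → ZMod 2 :=
  fun q => ∑ τ : Finset (V × Bool), if pface τ = q.2 then c (q.1, τ) else 0

open Classical in
/-- The mod 2 chain `OΔ × M ∈ C_{2k}(OL × L; ℤ/2)`. -/
noncomputable def chODeltaM [DecidableEq V] (Δ : Finset V) (M : Finset V → ZMod 2) (k : ℕ) :
    Finset (V × Bool) × Finset V → ZMod 2 :=
  fun q => if pface q.1 = Δ ∧ q.1.card = k + 1 then M q.2 else 0

/-- The mod 2 cellular boundary operator on chains of the configuration space `C(D)`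
(symmetric functions on ordered pairs): `∂(σ × τ) = ∂σ × τ + σ × ∂τ`. -/
noncomputable def cBd2 [Fintype V] [DecidableEq V]
    (c : Finset (V × Bool) × Finset (V × Bool) → ZMod 2) :
    Finset (V × Bool) × Finset (V × Bool) → ZMod 2 :=
  fun p => (∑ x ∈ p.1ᶜ, c (insert x p.1, p.2)) + (∑ x ∈ p.2ᶜ, c (p.1, insert x p.2))

/-- The `*`-condition for `(M, Δ)`: for all simplices `σ, τ` of `M` with
`Δ⁰ ⊆ σ ∪ τ` one has `σ ∩ τ ⊆ Δ`. -/
def StarCond [DecidableEq V] (M : Finset V → ZMod 2) (Δ : Finset V) : Prop :=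
  ∀ σ τ : Finset V, M σ ≠ 0 → M τ ≠ 0 → Δ ⊆ σ ∪ τ → σ ∩ τ ⊆ Δ

/-! ### Rational (reduced) simplicial homology -/

/-- The augmented rational simplicial boundary operator, on coefficient functions
`Finset V → ℚ` (the empty set plays the role of the `(-1)`-simplex, so this computes
reduced homology). -/
noncomputable def bdQ [Fintype V] [DecidableEq V] [LinearOrder V] :
    (Finset V → ℚ) →ₗ[ℚ] (Finset V → ℚ) where
  toFun c := fun t => ∑ x ∈ tᶜ, ((-1 : ℚ) ^ (t.filter (· < x)).card) * c (insert x t)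
  map_add' a b := by
    funext t
    simp [mul_add, Finset.sum_add_distrib]
  map_smul' r a := by
    funext t
    simp only [RingHom.id_apply, Pi.smul_apply, smul_eq_mul]
    rw [Finset.mul_sum]
    exact Finset.sum_congr rfl (fun x _ => by ring)

/-- The submodule of rational `k`-chains on `L`. -/
def chainsQ (L : SCplx V) (k : ℕ) : Submodule ℚ (Finset V → ℚ) where
  carrier := {c | ∀ s, c s ≠ 0 → s ∈ L.faces ∧ s.card = k + 1}
  add_mem' := by
    intro a b ha hb s hs
    by_cases h1 : a s = 0
    · by_cases h2 : b s = 0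
      · exact absurd (by simp [h1, h2]) hs
      · exact hb s h2
    · exact ha s h1
  zero_mem' := by intro s hs; simp at hs
  smul_mem' := by
    intro r a ha s hs
    refine ha s (fun h => hs ?_)
    simp [h]

/-- The reduced rational Betti number `b̄_k(L) = dim_ℚ H̃_k(L; ℚ)`. -/
noncomputable def redBetti [Fintype V] [DecidableEq V] [LinearOrder V]
    (L : SCplx V) (k : ℕ) : ℕ :=
  Module.finrank ℚ
    ((chainsQ L k ⊓ LinearMap.ker bdQ : Submodule ℚ (Finset V → ℚ)) ⧸
      (Submodule.comap (chainsQ L k ⊓ LinearMap.ker bdQ).subtype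
        (Submodule.map bdQ (chainsQ L (k + 1)))))

/-! ### Integral simplicial cohomology in the top degree -/

open Classical in
/-- The integral simplicial coboundary operator into degree `k` cochains on `L`. -/
noncomputable def cobOn [Fintype V] [DecidableEq V] [LinearOrder V] (L : SCplx V) (k : ℕ) :
    (Finset V → ℤ) →ₗ[ℤ] (Finset V → ℤ) where
  toFun φ := fun s => if s ∈ L.faces ∧ s.card = k + 1 then
      ∑ x ∈ s, ((-1 : ℤ) ^ (s.filter (· < x)).card) * φ (s.erase x) else 0
  map_add' a b := by
    funext s
    by_cases h : s ∈ L.faces ∧ s.card = k + 1 <;>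
      simp [h, mul_add, Finset.sum_add_distrib]
  map_smul' r a := by
    funext s
    simp only [RingHom.id_apply, Pi.smul_apply, smul_eq_mul]
    by_cases h : s ∈ L.faces ∧ s.card = k + 1
    · rw [if_pos h, if_pos h, Finset.mul_sum]
      exact Finset.sum_congr rfl (fun x _ => by ring)
    · rw [if_neg h, if_neg h, mul_zero]

/-- The submodule of integral `k`-cochains on `L` (functions supported on `k`-simplices). -/
def cochainsZ (L : SCplx V) (k : ℕ) : Submodule ℤ (Finset V → ℤ) where
  carrier := {c | ∀ s, c s ≠ 0 → s ∈ L.faces ∧ s.card = k + 1}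
  add_mem' := by
    intro a b ha hb s hs
    by_cases h1 : a s = 0
    · by_cases h2 : b s = 0
      · exact absurd (by simp [h1, h2]) hs
      · exact hb s h2
    · exact ha s h1
  zero_mem' := by intro s hs; simp at hs
  smul_mem' := by
    intro r a ha s hs
    refine ha s (fun h => hs ?_)
    simp [h]

open Classical in
/-- The submodule of integral `k`-coboundaries on `L`. -/
noncomputable def cobndZ [Fintype V] [DecidableEq V] [LinearOrder V]
    (L : SCplx V) (k : ℕ) : Submodule ℤ (Finset V → ℤ) :=
  if k = 0 then ⊥ else Submodule.map (cobOn L k) (cochainsZ L (k - 1))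

/-- The top-degree integral simplicial cohomology `H^k(L; ℤ)` (for `k = dim L` every
`k`-cochain is a cocycle). -/
noncomputable def topCohomologyZ [Fintype V] [DecidableEq V] [LinearOrder V]
    (L : SCplx V) (k : ℕ) :=
  (cochainsZ L k) ⧸ (Submodule.comap (cochainsZ L k).subtype (cobndZ L k))

noncomputable instance [Fintype V] [DecidableEq V] [LinearOrder V] (L : SCplx V) (k : ℕ) :
    AddCommGroup (topCohomologyZ L k) :=
  inferInstanceAs (AddCommGroup ((cochainsZ L k) ⧸
    (Submodule.comap (cochainsZ L k).subtype (cobndZ L k))))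

/-- A space is aspherical if it admits a contractible covering space. -/
def IsAspherical (X : Type) [TopologicalSpace X] : Prop :=
  ∃ (Y : Type) (_ : TopologicalSpace Y) (f : Y → X), IsCoveringMap f ∧ ContractibleSpace Y

section PBS

/-- Indicator function. -/
noncomputable def pInd [DecidableEq V] (τ : Finset V) : V → ℝ := fun v => if v ∈ τ then 1 else 0

/-- Barycenter. -/
noncomputable def pBar [DecidableEq V] (τ : Finset V) : V → ℝ := ((τ.card : ℝ)⁻¹) • pInd τ

/-- Sets of simplices spanning simplices of the partial barycentric subdivision. -/
def PGood [DecidableEq V] (L K : SCplx V) (T : Finset (Finset V)) : Prop :=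
  (∀ τ ∈ T, τ ∈ K.faces ∧ (τ ∈ L.faces → τ.card = 1)) ∧
  ∀ σ ∈ T, ∀ τ ∈ T, σ ⊆ τ ∨ τ ⊆ σ ∨ σ ∪ τ ∈ L.faces

variable [DecidableEq V] {L K : SCplx V}

lemma PGood.mono {T T' : Finset (Finset V)} (h : PGood L K T) (hs : T' ⊆ T) : PGood L K T' :=
  ⟨fun τ hτ => h.1 τ (hs hτ), fun σ hσ τ hτ => h.2 σ (hs hσ) τ (hs hτ)⟩

lemma PGood.sup_mem_L (hflag : IsFlag L) {T : Finset (Finset V)} (h : PGood L K T)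
    (hne : T.Nonempty) (hL : ∀ τ ∈ T, τ ∈ L.faces) : T.sup id ∈ L.faces := by
  apply hflag
  · obtain ⟨τ, hτ⟩ := hne
    obtain ⟨x, hx⟩ := K.nonempty_of_mem (h.1 τ hτ).1
    exact ⟨x, Finset.mem_sup.2 ⟨τ, hτ, hx⟩⟩
  · intro u hu w hw
    obtain ⟨σ, hσ, hu⟩ := Finset.mem_sup.1 hu
    obtain ⟨τ, hτ, hw⟩ := Finset.mem_sup.1 hw
    simp only [id] at hu hw
    obtain ⟨a, rfl⟩ := Finset.card_eq_one.1 ((h.1 σ hσ).2 (hL σ hσ))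
    obtain ⟨b, rfl⟩ := Finset.card_eq_one.1 ((h.1 τ hτ).2 (hL τ hτ))
    rw [Finset.mem_singleton] at hu hw
    subst hu hw
    rcases h.2 _ hσ _ hτ with h1 | h1 | h1
    · have : u = w := by simpa using h1
      subst this
      simpa using hL _ hσ
    · have : w = u := by simpa using h1
      subst this
      simpa using hL _ hσ
    · exact h1

lemma PGood.sup_mem (hflag : IsFlag L) {T : Finset (Finset V)} (h : PGood L K T)
    (hne : T.Nonempty) : T.sup id ∈ L.faces ∨ T.sup id ∈ T := by
  by_cases hL : ∀ τ ∈ T, τ ∈ L.faces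
  · exact Or.inl (h.sup_mem_L hflag hne hL)
  right
  push Not at hL
  obtain ⟨τ₀, hτ₀, hτ₀L⟩ := hL
  classical
  obtain ⟨τ, hτ, hmax⟩ := Finset.exists_max_image (T.filter (fun τ => τ ∉ L.faces)) Finset.card
    ⟨τ₀, Finset.mem_filter.2 ⟨hτ₀, hτ₀L⟩⟩
  rw [Finset.mem_filter] at hτ
  have : T.sup id = τ := by
    apply le_antisymm
    · apply Finset.sup_le
      intro σ hσ
      simp only [id]
      rcases h.2 σ hσ τ hτ.1 with h1 | h1 | h1
      · exact h1
      · have hσL : σ ∉ L.faces := fun hh =>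
          hτ.2 (L.down_closed hh h1 (K.nonempty_of_mem (h.1 τ hτ.1).1))
        have := hmax σ (Finset.mem_filter.2 ⟨hσ, hσL⟩)
        exact (Finset.eq_of_subset_of_card_le h1 this).symm.le
      · exact absurd (L.down_closed h1 Finset.subset_union_right
          (K.nonempty_of_mem (h.1 τ hτ.1).1)) hτ.2
    · exact Finset.le_sup (f := id) hτ.1
  rw [this]; exact hτ.1

lemma pInd_nonneg (τ : Finset V) (v : V) : 0 ≤ pInd τ v := by
  unfold pInd; split_ifs <;> norm_num

lemma pSum_pos_iff {T : Finset (Finset V)} {w : Finset V → ℝ} (hw : ∀ τ ∈ T, 0 < w τ) (v : V) :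
    0 < ∑ τ ∈ T, w τ * pInd τ v ↔ v ∈ T.sup id := by
  rw [Finset.sum_pos_iff_of_nonneg
    (fun τ hτ => mul_nonneg (hw τ hτ).le (pInd_nonneg τ v)), Finset.mem_sup]
  refine exists_congr fun τ => and_congr_right fun hτ => ?_
  by_cases hv : v ∈ τ <;> simp [pInd, hv, hw τ hτ]

lemma pTop_le (hflag : IsFlag L) {T T' : Finset (Finset V)} (h : PGood L K T)
    {w w' : Finset V → ℝ} (hw' : ∀ τ ∈ T', 0 < w' τ)
    (heq : ∀ v, ∑ τ ∈ T, w τ * pInd τ v = ∑ τ ∈ T', w' τ * pInd τ v) {U : Finset V}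
    (hU : U ∈ T) (hU' : U ∈ T') (hUL : U ∉ L.faces) (hsup : T.sup id = U) : w' U ≤ w U := by
  obtain ⟨v, hvU, hv⟩ : ∃ v ∈ U, v ∉ (T.erase U).sup id := by
    by_contra hcon
    push Not at hcon
    have he : (T.erase U).sup id = U := by
      apply le_antisymm
      · rw [← hsup]; exact Finset.sup_mono (Finset.erase_subset _ _)
      · exact hcon
    by_cases hne : (T.erase U).Nonempty
    · rcases (h.mono (Finset.erase_subset U T)).sup_mem hflag hne with h1 | h1
      · rw [he] at h1; exact hUL h1
      · rw [he] at h1; simp at h1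
    · rw [Finset.not_nonempty_iff_eq_empty] at hne
      rw [hne] at he
      have := K.nonempty_of_mem (h.1 U hU).1
      rw [← he] at this
      simp at this
  have h1 := heq v
  rw [← Finset.add_sum_erase T _ hU, ← Finset.add_sum_erase T' _ hU',
    Finset.sum_eq_zero (s := T.erase U)] at h1
  · have h2 : 0 ≤ ∑ τ ∈ T'.erase U, w' τ * pInd τ v :=
      Finset.sum_nonneg fun τ hτ =>
        mul_nonneg (hw' τ (Finset.mem_of_mem_erase hτ)).le (pInd_nonneg τ v)
    simp only [pInd, hvU, if_true] at h1 h2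
    linarith
  · intro τ hτ
    have : v ∉ τ := fun hh => hv (Finset.mem_sup.2 ⟨τ, hτ, hh⟩)
    simp [pInd, this]

lemma pSingle_sum {T : Finset (Finset V)} (hT : ∀ τ ∈ T, τ.card = 1) (w : Finset V → ℝ) (v : V) :
    ∑ τ ∈ T, w τ * pInd τ v = if {v} ∈ T then w {v} else 0 := by
  rw [← Finset.sum_ite_eq' T {v} w]
  refine Finset.sum_congr rfl fun τ hτ => ?_
  obtain ⟨a, rfl⟩ := Finset.card_eq_one.1 (hT τ hτ)
  by_cases h : v = a
  · subst h; simp [pInd]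
  · have : ({a} : Finset V) ≠ {v} := by simpa using Ne.symm h
    simp [pInd, h, Ne.symm h]

lemma pUnique (hflag : IsFlag L) (n : ℕ) : ∀ {T T' : Finset (Finset V)}, T.card = n →
    PGood L K T → PGood L K T' → ∀ {w w' : Finset V → ℝ}, (∀ τ ∈ T, 0 < w τ) →
    (∀ τ ∈ T', 0 < w' τ) →
    (∀ v, ∑ τ ∈ T, w τ * pInd τ v = ∑ τ ∈ T', w' τ * pInd τ v) →
    T = T' ∧ ∀ τ ∈ T, w τ = w' τ := by
  induction n with
  | zero =>
    intro T T' hc h h' w w' hw hw' heq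
    rw [Finset.card_eq_zero] at hc
    subst hc
    refine ⟨?_, by simp⟩
    by_contra hne
    obtain ⟨τ, hτ⟩ := Finset.nonempty_iff_ne_empty.2 (Ne.symm hne)
    obtain ⟨v, hv⟩ := K.nonempty_of_mem (h'.1 τ hτ).1
    have := (pSum_pos_iff hw' v).2 (Finset.mem_sup.2 ⟨τ, hτ, hv⟩)
    rw [← heq] at this
    simp at this
  | succ n ih =>
    intro T T' hc h h' w w' hw hw' heq
    have hsup : T.sup id = T'.sup id := by
      ext v
      rw [← pSum_pos_iff hw, ← pSum_pos_iff hw', heq]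
    have hne : T.Nonempty := Finset.card_pos.1 (by omega)
    have hne' : T'.Nonempty := by
      by_contra hcon
      rw [Finset.not_nonempty_iff_eq_empty] at hcon
      subst hcon
      obtain ⟨τ, hτ⟩ := hne
      obtain ⟨v, hv⟩ := K.nonempty_of_mem (h.1 τ hτ).1
      have : v ∈ T.sup id := Finset.mem_sup.2 ⟨τ, hτ, hv⟩
      rw [hsup] at this
      simp at this
    by_cases hL : T.sup id ∈ L.faces
    · have hone : ∀ τ ∈ T, τ.card = 1 := fun τ hτ => (h.1 τ hτ).2
        (L.down_closed hL (Finset.le_sup (f := id) hτ) (K.nonempty_of_mem (h.1 τ hτ).1))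
      have hone' : ∀ τ ∈ T', τ.card = 1 := fun τ hτ => (h'.1 τ hτ).2
        (L.down_closed (hsup ▸ hL) (Finset.le_sup (f := id) hτ)
          (K.nonempty_of_mem (h'.1 τ hτ).1))
      have key : ∀ v, (if {v} ∈ T then w {v} else 0) = if {v} ∈ T' then w' {v} else 0 := by
        intro v
        rw [← pSingle_sum hone, ← pSingle_sum hone', heq]
      constructor
      · ext τ
        constructor
        · intro hτ
          obtain ⟨a, rfl⟩ := Finset.card_eq_one.1 (hone τ hτ)
          by_contra hcon
          have := key a
          rw [if_pos hτ, if_neg hcon] at this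
          exact absurd this (hw _ hτ).ne'
        · intro hτ
          obtain ⟨a, rfl⟩ := Finset.card_eq_one.1 (hone' τ hτ)
          by_contra hcon
          have := key a
          rw [if_pos hτ, if_neg hcon] at this
          exact absurd this.symm (hw' _ hτ).ne'
      · intro τ hτ
        obtain ⟨a, rfl⟩ := Finset.card_eq_one.1 (hone τ hτ)
        have := key a
        rw [if_pos hτ] at this
        split_ifs at this with h2
        · exact this
        · exact absurd this (hw _ hτ).ne'
    · have hU : T.sup id ∈ T := (h.sup_mem hflag hne).resolve_left hL
      have hU' : T.sup id ∈ T' := by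
        rw [hsup]; exact (h'.sup_mem hflag hne').resolve_left (hsup ▸ hL)
      have hwU : w (T.sup id) = w' (T.sup id) := by
        apply le_antisymm
        · exact pTop_le hflag h' hw (fun v => (heq v).symm) hU' hU hL hsup.symm
        · exact pTop_le hflag h hw' heq hU hU' hL rfl
      generalize T.sup id = U at *
      have := ih (T := T.erase U) (T' := T'.erase U)
        (by rw [Finset.card_erase_of_mem hU]; omega)
        (h.mono (Finset.erase_subset _ _)) (h'.mono (Finset.erase_subset _ _))
        (w := w) (w' := w') (fun τ hτ => hw τ (Finset.mem_of_mem_erase hτ))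
        (fun τ hτ => hw' τ (Finset.mem_of_mem_erase hτ))
        (fun v => by
          have h1 := heq v
          rw [← Finset.add_sum_erase T _ hU, ← Finset.add_sum_erase T' _ hU', hwU] at h1
          linarith)
      constructor
      · rw [← Finset.insert_erase hU, ← Finset.insert_erase hU', this.1]
      · intro τ hτ
        by_cases hτU : τ = U
        · rw [hτU, hwU]
        · exact this.2 τ (Finset.mem_erase.2 ⟨hτU, hτ⟩)

/-- Uniqueness with nonnegative weights. -/
lemma pUnique' (hflag : IsFlag L) {T T' : Finset (Finset V)}
    (h : PGood L K T) (h' : PGood L K T') {w w' : Finset V → ℝ} (hw : ∀ τ ∈ T, 0 ≤ w τ)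
    (hw' : ∀ τ ∈ T', 0 ≤ w' τ)
    (heq : ∀ v, ∑ τ ∈ T, w τ * pInd τ v = ∑ τ ∈ T', w' τ * pInd τ v) :
    T.filter (fun τ => w τ ≠ 0) = T'.filter (fun τ => w' τ ≠ 0) ∧
      ∀ τ ∈ T.filter (fun τ => w τ ≠ 0), w τ = w' τ := by
  refine pUnique hflag _ rfl (h.mono (Finset.filter_subset _ _))
    (h'.mono (Finset.filter_subset _ _)) ?_ ?_ ?_
  · intro τ hτ
    rw [Finset.mem_filter] at hτ
    exact lt_of_le_of_ne (hw τ hτ.1) (Ne.symm hτ.2)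
  · intro τ hτ
    rw [Finset.mem_filter] at hτ
    exact lt_of_le_of_ne (hw' τ hτ.1) (Ne.symm hτ.2)
  · intro v
    rw [Finset.sum_filter_of_ne, Finset.sum_filter_of_ne, heq v]
    · intro τ _ h1; exact left_ne_zero_of_mul h1
    · intro τ _ h1; exact left_ne_zero_of_mul h1

lemma pExists (n : ℕ) : ∀ (S : Finset V) (f : V → ℝ), S.card ≤ n →
    (S = ∅ ∨ S ∈ K.faces) → (∀ v ∈ S, 0 < f v) → (∀ v ∉ S, f v = 0) →
    ∃ (T : Finset (Finset V)) (w : Finset V → ℝ), PGood L K T ∧ (∀ τ ∈ T, 0 < w τ) ∧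
      (∀ τ ∈ T, τ ⊆ S) ∧ ∀ v, ∑ τ ∈ T, w τ * pInd τ v = f v := by
  induction n with
  | zero =>
    intro S f hc hS hpos hz
    have : S = ∅ := Finset.card_eq_zero.1 (by omega)
    subst this
    exact ⟨∅, 0, ⟨by simp, by simp⟩, by simp, by simp, fun v => by simp [hz v]⟩
  | succ n ih =>
    intro S f hc hS hpos hz
    rcases hS with rfl | hS
    · exact ⟨∅, 0, ⟨by simp, by simp⟩, by simp, by simp, fun v => by simp [hz v]⟩
    by_cases hL : S ∈ L.faces
    · refine ⟨S.image (fun v => {v}), fun τ => ∑ v ∈ τ, f v, ⟨?_, ?_⟩, ?_, ?_, ?_⟩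
      · intro τ hτ
        obtain ⟨v, hv, rfl⟩ := Finset.mem_image.1 hτ
        exact ⟨K.down_closed hS (by simpa using hv) (by simp), by simp⟩
      · intro σ hσ τ hτ
        obtain ⟨u, hu, rfl⟩ := Finset.mem_image.1 hσ
        obtain ⟨v, hv, rfl⟩ := Finset.mem_image.1 hτ
        exact Or.inr (Or.inr (L.down_closed hL
          (Finset.union_subset (by simpa using hu) (by simpa using hv)) (by simp)))
      · intro τ hτ
        obtain ⟨v, hv, rfl⟩ := Finset.mem_image.1 hτ
        simpa using hpos v hv
      · intro τ hτ
        obtain ⟨v, hv, rfl⟩ := Finset.mem_image.1 hτ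
        simpa using hv
      · intro v
        rw [pSingle_sum]
        · by_cases hv : v ∈ S
          · simp [hv]
          · simp [hv, hz v hv]
        · intro τ hτ
          obtain ⟨v, hv, rfl⟩ := Finset.mem_image.1 hτ
          simp
    · obtain ⟨m, hm, hmin⟩ := Finset.exists_min_image S f (K.nonempty_of_mem hS)
      have hss : S.filter (fun v => f m < f v) ⊆ S.erase m := by
        intro v hv
        rw [Finset.mem_filter] at hv
        refine Finset.mem_erase.2 ⟨?_, hv.1⟩
        rintro rfl
        exact lt_irrefl _ hv.2
      obtain ⟨T, w, hT, hw, hTS, hsum⟩ := ih (S.filter (fun v => f m < f v))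
        (fun v => f v - f m * pInd S v)
        (by have := Finset.card_le_card hss
            rw [Finset.card_erase_of_mem hm] at this
            omega)
        (by
          rcases Finset.eq_empty_or_nonempty (S.filter (fun v => f m < f v)) with h1 | h1
          · exact Or.inl h1
          · exact Or.inr (K.down_closed hS (Finset.filter_subset _ _) h1))
        (by
          intro v hv
          rw [Finset.mem_filter] at hv
          simp [pInd, hv.1, hv.2])
        (by
          intro v hv
          rw [Finset.mem_filter] at hv
          by_cases hvS : v ∈ S
          · have h1 := hmin v hvS
            have h2 : ¬ f m < f v := fun hh => hv ⟨hvS, hh⟩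
            simp only [pInd, hvS, if_true]
            linarith
          · simp [pInd, hvS, hz v hvS])
      have hST : S ∉ T := fun hh => by
        have := hss (hTS S hh hm)
        simp at this
      have hTS' : ∀ τ ∈ T, τ ⊆ S := fun τ hτ => (hTS τ hτ).trans (Finset.filter_subset _ _)
      refine ⟨insert S T, fun τ => if τ = S then f m else w τ, ⟨?_, ?_⟩, ?_, ?_, ?_⟩
      · intro τ hτ
        rcases Finset.mem_insert.1 hτ with rfl | hτ
        · exact ⟨hS, fun hh => absurd hh hL⟩
        · exact hT.1 τ hτ
      · intro σ hσ τ hτ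
        rcases Finset.mem_insert.1 hσ with rfl | hσ1
        · rcases Finset.mem_insert.1 hτ with rfl | hτ1
          · exact Or.inl subset_rfl
          · exact Or.inr (Or.inl (hTS' τ hτ1))
        · rcases Finset.mem_insert.1 hτ with rfl | hτ1
          · exact Or.inl (hTS' σ hσ1)
          · exact hT.2 σ hσ1 τ hτ1
      · intro τ hτ
        rcases Finset.mem_insert.1 hτ with rfl | hτ
        · simpa using hpos m hm
        · have : τ ≠ S := fun hh => hST (hh ▸ hτ)
          simpa [this] using hw τ hτ
      · intro τ hτ
        rcases Finset.mem_insert.1 hτ with rfl | hτ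
        · exact subset_rfl
        · exact hTS' τ hτ
      · intro v
        rw [Finset.sum_insert hST]
        have : ∑ τ ∈ T, (if τ = S then f m else w τ) * pInd τ v = ∑ τ ∈ T, w τ * pInd τ v := by
          refine Finset.sum_congr rfl fun τ hτ => ?_
          have : τ ≠ S := fun hh => hST (hh ▸ hτ)
          simp [this]
        rw [this, hsum]
        simp

lemma pBar_inj {σ τ : Finset V} (hσ : σ.Nonempty) (hτ : τ.Nonempty) (h : pBar σ = pBar τ) :
    σ = τ := by
  have key : ∀ {ρ : Finset V}, ρ.Nonempty → ∀ v, pBar ρ v ≠ 0 ↔ v ∈ ρ := by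
    intro ρ hρ v
    have : (ρ.card : ℝ) ≠ 0 := by exact_mod_cast hρ.card_pos.ne'
    simp [pBar, pInd, hρ.ne_empty]
  ext v
  rw [← key hσ, ← key hτ, h]

lemma pBar_single (v : V) : pBar ({v} : Finset V) = stdVert v := by
  funext u
  simp [pBar, pInd, stdVert]

lemma pHull (s : Finset V) : convexHull ℝ (stdVert '' (s : Set V)) =
    {x | (∀ v, 0 ≤ x v) ∧ (∀ v ∉ s, x v = 0) ∧ ∑ v ∈ s, x v = 1} := by
  apply subset_antisymm
  · apply convexHull_min
    · rintro _ ⟨v, hv, rfl⟩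
      refine ⟨fun u => ?_, fun u hu => ?_, ?_⟩
      · unfold stdVert; split_ifs <;> norm_num
      · have : u ≠ v := fun hh => hu (hh ▸ hv)
        simp [stdVert, this]
      · have : v ∈ s := hv
        simp [stdVert, this]
    · rintro x ⟨hx1, hx2, hx3⟩ y ⟨hy1, hy2, hy3⟩ a b ha hb hab
      refine ⟨fun v => ?_, fun v hv => ?_, ?_⟩
      · have := hx1 v
        have := hy1 v
        simp only [Pi.add_apply, Pi.smul_apply, smul_eq_mul]
        positivity
      · simp [hx2 v hv, hy2 v hv]
      · simp only [Pi.add_apply, Pi.smul_apply, smul_eq_mul]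
        rw [Finset.sum_add_distrib, ← Finset.mul_sum, ← Finset.mul_sum, hx3, hy3]
        simpa using hab
  · rintro x ⟨hx1, hx2, hx3⟩
    have : x = ∑ v ∈ s, x v • stdVert v := by
      funext u
      rw [Finset.sum_apply]
      by_cases hu : u ∈ s
      · simp [stdVert, hu]
      · simp [stdVert, hu, hx2]
    rw [this]
    exact (convex_convexHull ℝ _).sum_mem (fun v _ => hx1 v) hx3
      (fun v hv => subset_convexHull ℝ _ ⟨v, hv, rfl⟩)

lemma pBar_mem_hull {τ s : Finset V} (hτ : τ.Nonempty) (h : τ ⊆ s) :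
    pBar τ ∈ convexHull ℝ (stdVert '' (s : Set V)) := by
  rw [pHull]
  have hc : (τ.card : ℝ) ≠ 0 := by exact_mod_cast hτ.card_pos.ne'
  refine ⟨fun v => ?_, fun v hv => ?_, ?_⟩
  · simp only [pBar, Pi.smul_apply, smul_eq_mul]
    have := pInd_nonneg τ v
    positivity
  · have : v ∉ τ := fun hh => hv (h hh)
    simp [pBar, pInd, this]
  · simp only [pBar, Pi.smul_apply, smul_eq_mul, ← Finset.mul_sum, pInd]
    rw [Finset.sum_ite_mem, Finset.inter_eq_right.2 h]
    simp [hc]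

lemma PGood.injOn {T : Finset (Finset V)} (h : PGood L K T) : Set.InjOn pBar (T : Set (Finset V)) :=
  fun σ hσ τ hτ he => pBar_inj (K.nonempty_of_mem (h.1 σ hσ).1) (K.nonempty_of_mem (h.1 τ hτ).1) he

open Classical in
lemma PGood.mem_hull {T : Finset (Finset V)} (h : PGood L K T) {x : V → ℝ}
    (hx : x ∈ convexHull ℝ ((T.image pBar : Finset (V → ℝ)) : Set (V → ℝ))) :
    ∃ w : Finset V → ℝ, (∀ τ ∈ T, 0 ≤ w τ) ∧ ∑ τ ∈ T, w τ * τ.card = 1 ∧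
      ∀ v, ∑ τ ∈ T, w τ * pInd τ v = x v := by
  rw [Finset.mem_convexHull'] at hx
  obtain ⟨g, hg0, hg1, hgx⟩ := hx
  rw [Finset.sum_image h.injOn] at hg1 hgx
  refine ⟨fun τ => g (pBar τ) * (τ.card : ℝ)⁻¹, ?_, ?_, ?_⟩
  · intro τ hτ
    exact mul_nonneg (hg0 _ (Finset.mem_image_of_mem _ hτ)) (by positivity)
  · rw [← hg1]
    refine Finset.sum_congr rfl fun τ hτ => ?_
    have : (τ.card : ℝ) ≠ 0 := by
      exact_mod_cast (K.nonempty_of_mem (h.1 τ hτ).1).card_pos.ne'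
    field_simp
  · intro v
    rw [← hgx, Finset.sum_apply]
    refine Finset.sum_congr rfl fun τ hτ => ?_
    simp [pBar, mul_assoc]

lemma PGood.hull_mem {T : Finset (Finset V)} (h : PGood L K T) {x : V → ℝ} {w : Finset V → ℝ}
    (hw : ∀ τ ∈ T, 0 ≤ w τ) (h1 : ∑ τ ∈ T, w τ * τ.card = 1)
    (hx : ∀ v, ∑ τ ∈ T, w τ * pInd τ v = x v) {A : Set (V → ℝ)}
    (hA : ∀ τ ∈ T, w τ ≠ 0 → pBar τ ∈ A) : x ∈ convexHull ℝ A := by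
  have : x = ∑ τ ∈ T.filter (fun τ => w τ ≠ 0), (w τ * τ.card) • pBar τ := by
    funext v
    rw [Finset.sum_apply, ← hx v]
    rw [← Finset.sum_filter_of_ne (p := fun τ => w τ ≠ 0)
      (fun τ _ h1 => left_ne_zero_of_mul h1)]
    refine Finset.sum_congr rfl fun τ hτ => ?_
    have : (τ.card : ℝ) ≠ 0 := by
      exact_mod_cast (K.nonempty_of_mem (h.1 τ (Finset.mem_filter.1 hτ).1).1).card_pos.ne'
    simp only [pBar, Pi.smul_apply, smul_eq_mul]
    field_simp
  rw [this]
  refine (convex_convexHull ℝ _).sum_mem (fun τ hτ => ?_) ?_ (fun τ hτ => ?_)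
  · exact mul_nonneg (hw τ (Finset.mem_filter.1 hτ).1) (by positivity)
  · rw [Finset.sum_filter_of_ne (fun τ _ h1 => left_ne_zero_of_mul h1), h1]
  · rw [Finset.mem_filter] at hτ
    exact subset_convexHull ℝ _ (hA τ hτ.1 hτ.2)

lemma PGood.linInd (hflag : IsFlag L) {T : Finset (Finset V)} (h : PGood L K T)
    {w : Finset V → ℝ} (h0 : ∀ v, ∑ τ ∈ T, w τ * pInd τ v = 0) : ∀ τ ∈ T, w τ = 0 := by
  have key := pUnique' hflag h h (w := fun τ => max (w τ) 0) (w' := fun τ => max (-w τ) 0)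
    (fun τ _ => le_max_right _ _) (fun τ _ => le_max_right _ _) (by
      intro v
      rw [← sub_eq_zero, ← Finset.sum_sub_distrib]
      refine Eq.trans ?_ (h0 v)
      refine Finset.sum_congr rfl fun τ hτ => ?_
      rw [← sub_mul]
      congr 1
      rcases le_total (w τ) 0 with h1 | h1
      · rw [max_eq_right h1, max_eq_left (by linarith)]; ring
      · rw [max_eq_left h1, max_eq_right (by linarith)]; ring)
  intro τ hτ
  by_contra hne
  rcases lt_or_gt_of_ne hne with h1 | h1
  · have : τ ∈ T.filter (fun τ => max (-w τ) 0 ≠ 0) := by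
      refine Finset.mem_filter.2 ⟨hτ, ?_⟩
      rw [max_eq_left (by linarith)]; linarith
    rw [← key.1, Finset.mem_filter, max_eq_right h1.le] at this
    exact this.2 rfl
  · have : τ ∈ T.filter (fun τ => max (w τ) 0 ≠ 0) := by
      refine Finset.mem_filter.2 ⟨hτ, ?_⟩
      rw [max_eq_left h1.le]; exact hne
    rw [key.1, Finset.mem_filter, max_eq_right (by linarith : -w τ ≤ 0)] at this
    exact this.2 rfl

open Classical in
/-- The partial barycentric subdivision of `K` relative to the flag complex `L`. -/
noncomputable def pbs (L K : SCplx V) (hflag : IsFlag L) :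
    Geometry.SimplicialComplex ℝ (V → ℝ) where
  faces := {t | ∃ T : Finset (Finset V), PGood L K T ∧ T.Nonempty ∧ t = T.image pBar}
  isRelLowerSet_faces := by
    rintro _ ⟨T, hT, hne, rfl⟩
    refine ⟨hne.image _, ?_⟩
    intro t ht htne
    obtain ⟨T', hT', rfl⟩ := Finset.subset_image_iff.1 ht
    exact ⟨T', hT.mono hT', Finset.image_nonempty.1 htne, rfl⟩
  indep := by
    rintro _ ⟨T, hT, hne, rfl⟩
    apply LinearIndependent.affineIndependent
    have h1 : LinearIndepOn ℝ id ((T.image pBar : Finset (V → ℝ)) : Set (V → ℝ)) := by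
      rw [linearIndepOn_finset_iff]
      intro g hg x hx
      obtain ⟨τ, hτ, rfl⟩ := Finset.mem_image.1 hx
      rw [Finset.sum_image hT.injOn] at hg
      have := hT.linInd hflag (w := fun τ => g (pBar τ) * (τ.card : ℝ)⁻¹) (by
        intro v
        have h2 := congrFun hg v
        rw [Finset.sum_apply] at h2
        rw [Pi.zero_apply] at h2
        rw [← h2]
        refine Finset.sum_congr rfl fun τ hτ => ?_
        simp [pBar, mul_assoc]) τ hτ
      have hc : ((τ.card : ℝ)⁻¹) ≠ 0 := inv_ne_zero (by
        exact_mod_cast (K.nonempty_of_mem (hT.1 τ hτ).1).card_pos.ne')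
      exact (mul_eq_zero.1 this).resolve_right hc
    exact h1
  inter_subset_convexHull := by
    rintro _ _ ⟨T, hT, hne, rfl⟩ ⟨T', hT', hne', rfl⟩ x ⟨hx, hx'⟩
    obtain ⟨w, hw, hw1, hwx⟩ := hT.mem_hull hx
    obtain ⟨w', hw', hw1', hwx'⟩ := hT'.mem_hull hx'
    have key := pUnique' hflag hT hT' hw hw' (fun v => by rw [hwx, hwx'])
    refine hT.hull_mem hw hw1 hwx ?_
    intro τ hτ hτ0
    have : τ ∈ T'.filter (fun τ => w' τ ≠ 0) := key.1 ▸ Finset.mem_filter.2 ⟨hτ, hτ0⟩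
    exact ⟨Finset.mem_coe.2 (Finset.mem_image_of_mem _ hτ),
      Finset.mem_coe.2 (Finset.mem_image_of_mem _ (Finset.mem_filter.1 this).1)⟩

end PBS

open Classical in
theorem partial_barycentric_subdivision
    {V : Type} [DecidableEq V] (L K : SCplx V)
    (hLK : L.faces ⊆ K.faces) (hflag : IsFlag L) :
    ∃ S : Geometry.SimplicialComplex ℝ (V → ℝ),
      S.space = realization K ∧
      (∀ t ∈ S.faces, ∃ s ∈ K.faces, convexHull ℝ (↑t : Set (V → ℝ)) ⊆
        convexHull ℝ (stdVert '' (↑s : Set V))) ∧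
      (∀ s ∈ L.faces, s.image stdVert ∈ S.faces) ∧
      (∀ t ∈ S.faces, (↑t : Set (V → ℝ)) ⊆ stdVert '' {v | ({v} : Finset V) ∈ L.faces} →
        ∃ s ∈ L.faces, t = s.image stdVert) ∧
      (∀ t : Finset (V → ℝ), t.Nonempty →
        (∀ x ∈ t, ∀ y ∈ t, ({x, y} : Finset (V → ℝ)) ∈ S.faces) → t ∈ S.faces) := by
  have hsub : ∀ T : Finset (Finset V), PGood L K T → T.Nonempty →
      ∃ s ∈ K.faces, convexHull ℝ (↑(T.image pBar) : Set (V → ℝ)) ⊆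
        convexHull ℝ (stdVert '' (↑s : Set V)) := by
    intro T hT hne
    refine ⟨T.sup id, ?_, ?_⟩
    · rcases hT.sup_mem hflag hne with h | h
      · exact hLK h
      · exact (hT.1 _ h).1
    · apply convexHull_min _ (convex_convexHull ℝ _)
      intro x hx
      obtain ⟨τ, hτ, rfl⟩ := Finset.mem_image.1 (Finset.mem_coe.1 hx)
      exact pBar_mem_hull (K.nonempty_of_mem (hT.1 τ hτ).1) (Finset.le_sup (f := id) hτ)
  refine ⟨pbs L K hflag, ?_, ?_, ?_, ?_, ?_⟩
  · ext x
    rw [Geometry.SimplicialComplex.mem_space_iff]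
    simp only [realization, Set.mem_iUnion]
    constructor
    · rintro ⟨_, ⟨T, hT, hne, rfl⟩, hx⟩
      obtain ⟨s, hs, h⟩ := hsub T hT hne
      exact ⟨s, hs, h hx⟩
    · rintro ⟨s, hs, hx⟩
      rw [pHull] at hx
      obtain ⟨hx1, hx2, hx3⟩ := hx
      obtain ⟨T, w, hT, hw, hTS, hsum⟩ := pExists (L := L) (K := K) _
        (s.filter (fun v => x v ≠ 0)) x le_rfl
        (by
          rcases Finset.eq_empty_or_nonempty (s.filter (fun v => x v ≠ 0)) with h1 | h1
          · exact Or.inl h1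
          · exact Or.inr (K.down_closed hs (Finset.filter_subset _ _) h1))
        (by
          intro v hv
          exact lt_of_le_of_ne (hx1 v) (Ne.symm (Finset.mem_filter.1 hv).2))
        (by
          intro v hv
          by_contra hcon
          exact hv (Finset.mem_filter.2 ⟨by_contra fun h => hcon (hx2 v h), hcon⟩))
      have hone : ∑ τ ∈ T, w τ * τ.card = 1 := by
        rw [← hx3]
        simp_rw [← hsum]
        rw [Finset.sum_comm]
        refine Finset.sum_congr rfl fun τ hτ => ?_
        rw [← Finset.mul_sum]
        congr 1
        have : τ ⊆ s := (hTS τ hτ).trans (Finset.filter_subset _ _)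
        simp only [pInd]
        rw [Finset.sum_ite_mem, Finset.inter_eq_right.2 this]
        simp
      refine ⟨T.image pBar, ⟨T, hT, ?_, rfl⟩, ?_⟩
      · rw [Finset.nonempty_iff_ne_empty]
        rintro rfl
        simp at hone
      · exact hT.hull_mem (fun τ hτ => (hw τ hτ).le) hone hsum
          (fun τ hτ _ => Finset.mem_coe.2 (Finset.mem_image_of_mem _ hτ))
  · rintro _ ⟨T, hT, hne, rfl⟩
    exact hsub T hT hne
  · intro s hs
    refine ⟨s.image (fun v => {v}), ⟨?_, ?_⟩, (L.nonempty_of_mem hs).image _, ?_⟩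
    · intro τ hτ
      obtain ⟨v, hv, rfl⟩ := Finset.mem_image.1 hτ
      exact ⟨K.down_closed (hLK hs) (by simpa using hv) (by simp), by simp⟩
    · intro σ hσ τ hτ
      obtain ⟨u, hu, rfl⟩ := Finset.mem_image.1 hσ
      obtain ⟨v, hv, rfl⟩ := Finset.mem_image.1 hτ
      exact Or.inr (Or.inr (L.down_closed hs
        (Finset.union_subset (by simpa using hu) (by simpa using hv)) (by simp)))
    · rw [Finset.image_image]
      refine Finset.image_congr fun v _ => ?_
      exact (pBar_single v).symm
  · rintro _ ⟨T, hT, hne, rfl⟩ ht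
    have hT1 : ∀ τ ∈ T, ∃ v, τ = {v} ∧ ({v} : Finset V) ∈ L.faces := by
      intro τ hτ
      obtain ⟨v, hv, he⟩ := ht (Finset.mem_coe.2 (Finset.mem_image_of_mem pBar hτ))
      rw [← pBar_single] at he
      exact ⟨v, (pBar_inj (by simp) (K.nonempty_of_mem (hT.1 τ hτ).1) he).symm, hv⟩
    refine ⟨T.sup id, hT.sup_mem_L hflag hne ?_, ?_⟩
    · intro τ hτ
      obtain ⟨v, rfl, hv⟩ := hT1 τ hτ
      exact hv
    · ext x
      simp only [Finset.mem_image, Finset.mem_sup, id]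
      constructor
      · rintro ⟨τ, hτ, rfl⟩
        obtain ⟨v, rfl, hv⟩ := hT1 τ hτ
        exact ⟨v, ⟨_, hτ, by simp⟩, (pBar_single v).symm⟩
      · rintro ⟨v, ⟨τ, hτ, hvτ⟩, rfl⟩
        obtain ⟨u, rfl, hv⟩ := hT1 τ hτ
        rw [Finset.mem_singleton] at hvτ
        subst hvτ
        exact ⟨_, hτ, pBar_single v⟩
  · intro t hne hpair
    have hsubset : (t : Set (V → ℝ)) ⊆
        pBar '' {τ : Finset V | τ ∈ K.faces ∧ (τ ∈ L.faces → τ.card = 1)} := by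
      intro x hx
      obtain ⟨T, hT, -, he⟩ := hpair x hx x hx
      have : x ∈ T.image pBar := he ▸ by simp
      obtain ⟨τ, hτ, rfl⟩ := Finset.mem_image.1 this
      exact ⟨τ, hT.1 τ hτ, rfl⟩
    obtain ⟨T, hTP, rfl⟩ := Finset.subset_set_image_iff.1 hsubset
    have hTP' : ∀ τ ∈ T, τ ∈ K.faces ∧ (τ ∈ L.faces → τ.card = 1) := fun τ hτ => hTP hτ
    refine ⟨T, ⟨hTP', ?_⟩, Finset.image_nonempty.1 hne, rfl⟩
    intro σ hσ τ hτ
    obtain ⟨T', hT', -, he⟩ := hpair _ (Finset.mem_image_of_mem pBar hσ) _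
      (Finset.mem_image_of_mem pBar hτ)
    have mem : ∀ ρ ∈ T, pBar ρ ∈ T'.image pBar → ρ ∈ T' := by
      intro ρ hρ h
      obtain ⟨ρ', hρ', h2⟩ := Finset.mem_image.1 h
      rw [pBar_inj (K.nonempty_of_mem (hTP' ρ hρ).1) (K.nonempty_of_mem (hT'.1 ρ' hρ').1) h2.symm]
      exact hρ'
    exact hT'.2 σ (mem σ hσ (he ▸ by simp)) τ (mem τ hτ (he ▸ by simp))
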